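/- There exists T* > 0, depending only on b and ‖V''‖∞ := sup_x ‖V''(x)‖, with the following property: for every piecewise continuous E : ℝ → ℝ^N, every x₀, ẋ₀ ∈ ℝ^N, with x_c the solution of x_c'' + ∇V(x_c) = E, x_c(0) = x₀, x_c'(0) = ẋ₀, the maximal solution Q : [0, T⁺) → M_N(ℂ) of Q' + Q² + V''(x_c(t)) = 0, Q(0) = i b I_N, satisfies T⁺ > T*, and for every t ∈ [0, T*] the imaginary part Q₂(t) := Im Q(t) is a real symmetric matrix satisfying (b/2) I_N ≤ Q₂(t) ≤ (3b/2) I_N in the Loewner order (i.e. both Q₂(t) − (b/2)I_N and (3b/2)I_N − Q₂(t) are positive semidefinite). -/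

import Mathlib

open MeasureTheory Matrix Real Set Filter
open scoped InnerProductSpace ENNReal Topology

noncomputable section

attribute [local instance] Matrix.normedAddCommGroup Matrix.normedSpace

/-- `ℝ^N` as a Euclidean space. -/
abbrev EucSp (N : ℕ) := EuclideanSpace ℝ (Fin N)

/-- A potential `V : ℝ^N → ℝ` is subquadratic if it is `C^∞` and all its derivatives of
order `≥ 2` are (globally) bounded. -/
def Subquadratic {N : ℕ} (V : EucSp N → ℝ) : Prop :=
  ContDiff ℝ (⊤ : ℕ∞) V ∧ ∀ n : ℕ, 2 ≤ n → ∃ C : ℝ, ∀ x, ‖iteratedFDeriv ℝ n V x‖ ≤ C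

/-- `E : ℝ → ℝ^N` is piecewise continuous: on each compact interval it has finitely many
discontinuities and is bounded. -/
def PiecewiseContinuous {N : ℕ} (E : ℝ → EucSp N) : Prop :=
  ∀ a b : ℝ, ∃ s : Finset ℝ,
    (∀ t ∈ Set.Icc a b, t ∉ s → ContinuousAt E t) ∧ ∃ C : ℝ, ∀ t ∈ Set.Icc a b, ‖E t‖ ≤ C

/-- The Hessian matrix `V''(x)` of `V` at `x`. -/
def hessMat {N : ℕ} (V : EucSp N → ℝ) (x : EucSp N) : Matrix (Fin N) (Fin N) ℝ :=
  Matrix.of fun i j =>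
    iteratedFDeriv ℝ 2 V x ![EuclideanSpace.single i 1, EuclideanSpace.single j 1]

/-- The operator norm of a matrix, induced by the Euclidean norm. -/
def opNorm {N : ℕ} {𝕜 : Type} [RCLike 𝕜] (M : Matrix (Fin N) (Fin N) 𝕜) : ℝ :=
  ‖LinearMap.toContinuousLinearMap (Matrix.toEuclideanLin M)‖

/-- Real part of a complex matrix. -/
def RePart {N : ℕ} (M : Matrix (Fin N) (Fin N) ℂ) : Matrix (Fin N) (Fin N) ℝ :=
  M.map Complex.re

/-- Imaginary part of a complex matrix. -/
def ImPart {N : ℕ} (M : Matrix (Fin N) (Fin N) ℂ) : Matrix (Fin N) (Fin N) ℝ :=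
  M.map Complex.im

/-- The normalization constant `C_N = (∫_{ℝ^N} e^{-‖y‖²} dy)^{1/2}`. -/
def CN (N : ℕ) : ℝ := Real.sqrt (∫ y : EucSp N, Real.exp (-‖y‖ ^ 2))

/-- The constant `C_* = (1/(6 C_N)) (∫_{ℝ^N} ‖y‖⁶ e^{-‖y‖²} dy)^{1/2}`. -/
def Cstar (N : ℕ) : ℝ :=
  (1 / (6 * CN N)) * Real.sqrt (∫ y : EucSp N, ‖y‖ ^ 6 * Real.exp (-‖y‖ ^ 2))

/-- `(x_c, v)` is a (global, `C¹`) solution of the controlled Newton equation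
`x_c'' + ∇V(x_c) = E`, `x_c(0) = x₀`, `x_c'(0) = v₀`; the second-order ODE holds at every
point where `E` is continuous. -/
def IsNewtonSol {N : ℕ} (V : EucSp N → ℝ) (E : ℝ → EucSp N) (x₀ v₀ : EucSp N)
    (x_c v : ℝ → EucSp N) : Prop :=
  x_c 0 = x₀ ∧ v 0 = v₀ ∧ Continuous v ∧ (∀ t, HasDerivAt x_c (v t) t) ∧
    ∀ t, ContinuousAt E t → HasDerivAt v (E t - gradient V (x_c t)) t

/-- Right-hand side of the Riccati equation `Q' = -(Q² + V''(x_c t))`. -/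
def riccatiF {N : ℕ} (V : EucSp N → ℝ) (x_c : ℝ → EucSp N)
    (Q : ℝ → Matrix (Fin N) (Fin N) ℂ) (t : ℝ) : Matrix (Fin N) (Fin N) ℂ :=
  -(Q t ^ 2 + (hessMat V (x_c t)).map (fun a : ℝ => (a : ℂ)))

/-- The initial datum `i b I_N`. -/
def riccatiInit (N : ℕ) (b : ℝ) : Matrix (Fin N) (Fin N) ℂ :=
  ((b : ℂ) * Complex.I) • (1 : Matrix (Fin N) (Fin N) ℂ)

/-- The bilinear form `⟨M y, y⟩ = ∑ᵢⱼ Mᵢⱼ yⱼ yᵢ` on `ℂ^N`, for a real vector `y`. -/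
def qFormC {N : ℕ} (M : Matrix (Fin N) (Fin N) ℂ) (y : EucSp N) : ℂ :=
  ∑ i, ∑ j, M i j * (y j : ℂ) * (y i : ℂ)

/-- The quadratic form `⟨M y, y⟩ = ∑ᵢⱼ Mᵢⱼ yⱼ yᵢ` on `ℝ^N`. -/
def qFormR {N : ℕ} (M : Matrix (Fin N) (Fin N) ℝ) (y : EucSp N) : ℝ :=
  ∑ i, ∑ j, M i j * y j * y i

/-- The classical action
`S(t,x) = ∫₀ᵗ (½‖x_c'(s)‖² - V(x_c(s))) ds + ⟨x_c'(t), x - x_c(t)⟩`. -/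
def action {N : ℕ} (V : EucSp N → ℝ) (x_c v : ℝ → EucSp N) (t : ℝ) (x : EucSp N) : ℝ :=
  (∫ s in (0:ℝ)..t, ((1:ℝ)/2 * ‖v s‖ ^ 2 - V (x_c s))) + ⟪v t, x - x_c t⟫_ℝ

/-- The trajectory-coherent state `ψ̃(t,x)`. -/
def psiTilde {N : ℕ} (V : EucSp N → ℝ) (E : ℝ → EucSp N) (b : ℝ)
    (x_c v : ℝ → EucSp N) (Q : ℝ → Matrix (Fin N) (Fin N) ℂ) (t : ℝ) (x : EucSp N) : ℂ :=
  ((b ^ ((N : ℝ) / 4) / CN N : ℝ) : ℂ) *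
    Complex.exp (Complex.I * (((action V x_c v t x : ℝ) : ℂ)
        + (1/2 : ℂ) * qFormC (Q t) (x - x_c t))
      + ∫ s in (0:ℝ)..t, (Complex.I * ((⟪x_c s, E s⟫_ℝ : ℝ) : ℂ) - (Q s).trace / 2))

/-- The third-order Taylor remainder of `V` at `x_c(t)`:
`V(x) - V(x_c) - ⟨∇V(x_c), x - x_c⟩ - ½⟨V''(x_c)(x - x_c), x - x_c⟩`. -/
def taylorRem3 {N : ℕ} (V : EucSp N → ℝ) (x_c : ℝ → EucSp N) (t : ℝ) (x : EucSp N) : ℝ :=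
  V x - V (x_c t) - ⟪gradient V (x_c t), x - x_c t⟫_ℝ
    - (1/2) * qFormR (hessMat V (x_c t)) (x - x_c t)

/-- The source term `r(t,x)` (Taylor remainder of `V` at `x_c(t)` multiplied by `-ψ̃`). -/
def rRem {N : ℕ} (V : EucSp N → ℝ) (E : ℝ → EucSp N) (b : ℝ)
    (x_c v : ℝ → EucSp N) (Q : ℝ → Matrix (Fin N) (Fin N) ℂ) (t : ℝ) (x : EucSp N) : ℂ :=
  -((taylorRem3 V x_c t x : ℝ) : ℂ) * psiTilde V E b x_c v Q t x

/-- Membership in the class `𝒱` of unit-norm states whose modulus is a Gaussian with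
covariance parameter `q` between `√(b/2) I_N` and `√(3b/2) I_N`. -/
def InGaussClass (N : ℕ) (b : ℝ) (φ : EucSp N → ℂ) : Prop :=
  eLpNorm φ 2 volume = 1 ∧
    ∃ (q : Matrix (Fin N) (Fin N) ℝ) (α : EucSp N), q.PosSemidef ∧
      (q - Real.sqrt (b/2) • 1).PosSemidef ∧ (Real.sqrt (3*b/2) • 1 - q).PosSemidef ∧
      ∀ᵐ x : EucSp N, ‖φ x‖ ^ 2 =
        q.det / (CN N) ^ 2 * Real.exp (-∑ i, (q.mulVec (fun j => x j - α j) i) ^ 2)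

/-- The set `𝒱` inside `L²(ℝ^N, ℂ)`. -/
def GaussSet (N : ℕ) (b : ℝ) : Set (Lp ℂ 2 (volume : Measure (EucSp N))) :=
  {φ | InGaussClass N b ⇑φ}

end

section Abstract

variable {A : Type*} [NormedRing A] [NormedAlgebra ℝ A]

lemma riccati_lip (K : NNReal) (h : A) :
    LipschitzOnWith (2 * K) (fun q : A => -(q ^ 2 + h)) (Metric.closedBall 0 K) := by
  apply LipschitzOnWith.of_dist_le_mul
  intro x hx y hy
  rw [mem_closedBall_zero_iff] at hx hy
  rw [dist_eq_norm, dist_eq_norm]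
  have e : -(x ^ 2 + h) - -(y ^ 2 + h) = -(x * (x - y) + (x - y) * y) := by noncomm_ring
  rw [e, norm_neg]
  calc ‖x * (x - y) + (x - y) * y‖ ≤ ‖x * (x - y)‖ + ‖(x - y) * y‖ := norm_add_le _ _
    _ ≤ ‖x‖ * ‖x - y‖ + ‖x - y‖ * ‖y‖ := add_le_add (norm_mul_le _ _) (norm_mul_le _ _)
    _ ≤ K * ‖x - y‖ + ‖x - y‖ * K := by gcongr
    _ = _ := by push_cast; ring

lemma riccati_exists [CompleteSpace A] (H : ℝ → A) (hH : Continuous H) (M b : ℝ) (hb : 0 < b)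
    (hM : 0 ≤ M) (hHM : ∀ t, ‖H t‖ ≤ M) (q0 : A) (hq0 : ‖q0‖ ≤ b) (T : ℝ) (hT0 : 0 ≤ T)
    (hT : (9 / 4 * b ^ 2 + M) * T ≤ b / 2) :
    ∃ R : ℝ → A, R 0 = q0 ∧ (∀ t ∈ Set.Icc 0 T,
      HasDerivWithinAt R (-(R t ^ 2 + H t)) (Set.Icc 0 T) t) ∧ ∀ t, ‖R t - q0‖ ≤ b / 2 := by
  have hball : ∀ q ∈ Metric.closedBall q0 (b / 2), ‖q‖ ≤ 3 * b / 2 := by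
    intro q hq
    rw [mem_closedBall_iff_norm] at hq
    calc ‖q‖ = ‖(q - q0) + q0‖ := by simp
      _ ≤ ‖q - q0‖ + ‖q0‖ := norm_add_le _ _
      _ ≤ 3 * b / 2 := by linarith
  let a : NNReal := ⟨b / 2, by positivity⟩
  let L : NNReal := ⟨9 / 4 * b ^ 2 + M, by positivity⟩
  let K : NNReal := ⟨3 * b / 2, by positivity⟩
  have hf : IsPicardLindelof (fun t (q : A) => -(q ^ 2 + H t))
      (⟨0, ⟨le_rfl, hT0⟩⟩ : Set.Icc (0:ℝ) T) q0 a 0 L (2 * K) := by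
    refine ⟨?_, ?_, ?_, ?_⟩
    · intro t _
      refine (riccati_lip K (H t)).mono ?_
      intro q hq
      rw [mem_closedBall_zero_iff]
      exact hball q hq
    · intro q _
      fun_prop
    · intro t _ q hq
      have h1 := hball q hq
      rw [norm_neg]
      calc ‖q ^ 2 + H t‖ ≤ ‖q ^ 2‖ + ‖H t‖ := norm_add_le _ _
        _ ≤ ‖q‖ ^ 2 + M := add_le_add (by rw [pow_two, pow_two]; exact norm_mul_le _ _) (hHM t)
        _ ≤ (3 * b / 2) ^ 2 + M := by gcongr
        _ = 9 / 4 * b ^ 2 + M := by ring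
    · have : max (T - 0) ((0:ℝ) - 0) = T := by simp [hT0]
      show (9 / 4 * b ^ 2 + M) * max (T - 0) ((0:ℝ) - 0) ≤ b / 2 - ((0 : NNReal) : ℝ)
      rw [this]
      simpa using hT
  obtain ⟨α, hα⟩ := ODE.FunSpace.exists_isFixedPt_next hf (Metric.mem_closedBall_self le_rfl)
  refine ⟨α.compProj, ?_, ?_, ?_⟩
  · have := ODE.FunSpace.compProj_val (α := α) (t := ⟨0, ⟨le_rfl, hT0⟩⟩)
    rw [this, ← hα, ODE.FunSpace.next_apply₀]
  · intro t ht
    apply ODE.hasDerivWithinAt_picard_Icc (f := fun t (q : A) => -(q ^ 2 + H t))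
      (t₀ := 0) ⟨le_rfl, hT0⟩ hf.continuousOn_uncurry
      α.continuous_compProj.continuousOn (fun _ ht' ↦ α.compProj_mem_closedBall hf.mul_max_le)
      q0 ht |>.congr_of_mem _ ht
    intro t' ht'
    nth_rw 1 [← hα]
    rw [ODE.FunSpace.compProj_of_mem ht', ODE.FunSpace.next_apply]
  · intro t
    have := α.compProj_mem_closedBall hf.mul_max_le (t := t)
    rwa [mem_closedBall_iff_norm] at this

lemma riccati_unique (H : ℝ → A) (T : ℝ) (Q R : ℝ → A) (h0 : Q 0 = R 0)
    (hQ : ∀ t ∈ Set.Icc 0 T, HasDerivWithinAt Q (-(Q t ^ 2 + H t)) (Set.Ici 0) t)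
    (hR : ∀ t ∈ Set.Icc 0 T, HasDerivWithinAt R (-(R t ^ 2 + H t)) (Set.Ici 0) t) :
    Set.EqOn Q R (Set.Icc 0 T) := by
  have hQc : ContinuousOn Q (Set.Icc 0 T) := fun t ht =>
    (hQ t ht).continuousWithinAt.mono Set.Icc_subset_Ici_self
  have hRc : ContinuousOn R (Set.Icc 0 T) := fun t ht =>
    (hR t ht).continuousWithinAt.mono Set.Icc_subset_Ici_self
  obtain ⟨C1, hC1⟩ := isCompact_Icc.exists_bound_of_continuousOn hQc
  obtain ⟨C2, hC2⟩ := isCompact_Icc.exists_bound_of_continuousOn hRc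
  let K : NNReal := ⟨max 0 (max C1 C2), le_max_left _ _⟩
  have hK1 : C1 ≤ (K : ℝ) := (le_max_left C1 C2).trans (le_max_right _ _)
  have hK2 : C2 ≤ (K : ℝ) := (le_max_right C1 C2).trans (le_max_right _ _)
  refine ODE_solution_unique_of_mem_Icc_right (v := fun t q => -(q ^ 2 + H t))
    (s := fun _ => Metric.closedBall 0 K) (K := 2 * K)
    (fun t _ => riccati_lip K (H t)) hQc ?_ ?_ hRc ?_ ?_ h0
  · intro t ht
    exact (hQ t ⟨ht.1, ht.2.le⟩).mono (Set.Ici_subset_Ici.2 ht.1)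
  · intro t ht
    rw [mem_closedBall_zero_iff]
    exact (hC1 t ⟨ht.1, ht.2.le⟩).trans hK1
  · intro t ht
    exact (hR t ⟨ht.1, ht.2.le⟩).mono (Set.Ici_subset_Ici.2 ht.1)
  · intro t ht
    rw [mem_closedBall_zero_iff]
    exact (hC2 t ⟨ht.1, ht.2.le⟩).trans hK2

end Abstract

section L2

open scoped Matrix.Norms.L2Operator

lemma norm_cmap_le {N : ℕ} (B : Matrix (Fin N) (Fin N) ℝ) :
    ‖B.map (fun a : ℝ => (a : ℂ))‖ ≤ 2 * opNorm B := by
  rw [Matrix.l2_opNorm_def]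
  refine ContinuousLinearMap.opNorm_le_bound _ (by unfold opNorm; positivity) fun z => ?_
  let x : EucSp N := WithLp.toLp 2 fun i => (z i).re
  let y : EucSp N := WithLp.toLp 2 fun i => (z i).im
  have hz : ‖z‖ ^ 2 = ‖x‖ ^ 2 + ‖y‖ ^ 2 := by
    simp only [EuclideanSpace.norm_sq_eq, x, y, ← Finset.sum_add_distrib]
    refine Finset.sum_congr rfl fun i _ => ?_
    rw [Complex.sq_norm, Complex.normSq_apply]
    simp [pow_two]
  let c := LinearMap.toContinuousLinearMap (Matrix.toEuclideanLin B)
  have hx : ‖c x‖ ≤ opNorm B * ‖x‖ := c.le_opNorm x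
  have hy : ‖c y‖ ≤ opNorm B * ‖y‖ := c.le_opNorm y
  have hw : ‖((Matrix.toEuclideanLin (𝕜 := ℂ)).trans LinearMap.toContinuousLinearMap
      (B.map (fun a : ℝ => (a : ℂ)))) z‖ ^ 2 = ‖c x‖ ^ 2 + ‖c y‖ ^ 2 := by
    simp only [EuclideanSpace.norm_sq_eq, ← Finset.sum_add_distrib]
    refine Finset.sum_congr rfl fun i _ => ?_
    rw [Complex.sq_norm, Complex.normSq_apply]
    simp [c, x, y, pow_two, Matrix.mulVec, dotProduct]
  have h0 : 0 ≤ opNorm B := by unfold opNorm; positivity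
  refine le_of_sq_le_sq ?_ (by positivity)
  rw [hw, mul_pow, hz]
  nlinarith [pow_le_pow_left₀ (norm_nonneg _) hx 2, pow_le_pow_left₀ (norm_nonneg _) hy 2, sq_nonneg (opNorm B * ‖x‖), sq_nonneg (opNorm B * ‖y‖)]

lemma im_form_le {N : ℕ} (D : Matrix (Fin N) (Fin N) ℂ) (x : Fin N → ℝ) :
    |x ⬝ᵥ (ImPart D *ᵥ x)| ≤ ‖D‖ * (x ⬝ᵥ x) := by
  let z : EuclideanSpace ℂ (Fin N) := WithLp.toLp 2 fun i => (x i : ℂ)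
  have hz : ‖z‖ ^ 2 = x ⬝ᵥ x := by
    rw [EuclideanSpace.norm_sq_eq]
    simp [z, dotProduct, pow_two]
  let c := Matrix.toEuclideanCLM (n := Fin N) (𝕜 := ℂ) D
  have h1 : ‖inner ℂ z (c z)‖ ≤ ‖D‖ * ‖z‖ ^ 2 := by
    have h2 : ‖c z‖ ≤ ‖D‖ * ‖z‖ := c.le_opNorm z
    calc _ ≤ ‖z‖ * ‖c z‖ := norm_inner_le_norm _ _
      _ ≤ ‖z‖ * (‖D‖ * ‖z‖) := by gcongr
      _ = _ := by ring
  have h3 : x ⬝ᵥ (ImPart D *ᵥ x) = (inner ℂ z (c z)).im := by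
    simp [PiLp.inner_apply, c, z, ImPart, dotProduct, Matrix.mulVec, mul_comm]
  rw [h3, ← hz]
  exact (Complex.abs_im_le_norm _).trans h1

lemma two_le_smooth : (2 : WithTop ℕ∞) ≤ ((⊤ : ℕ∞) : WithTop ℕ∞) :=
  WithTop.coe_le_coe.2 (le_top : (2 : ℕ∞) ≤ ⊤)

lemma hessMat_symm {N : ℕ} {V : EucSp N → ℝ} (hV : Subquadratic V) (x : EucSp N) :
    (hessMat V x)ᵀ = hessMat V x := by
  have hs : IsSymmSndFDerivAt ℝ V x :=
    (hV.1.contDiffAt).isSymmSndFDerivAt (by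
      rw [minSmoothness_of_isRCLikeNormedField]; exact two_le_smooth)
  ext i j
  simp only [hessMat, Matrix.transpose_apply, Matrix.of_apply, iteratedFDeriv_two_apply]
  exact hs _ _

lemma hessMat_cont {N : ℕ} {V : EucSp N → ℝ} (hV : Subquadratic V) :
    Continuous (hessMat V) := by
  have h := hV.1.continuous_iteratedFDeriv (m := 2) two_le_smooth
  refine continuous_matrix fun i j => ?_
  simp only [hessMat, Matrix.of_apply]
  exact (ContinuousMultilinearMap.apply ℝ (fun _ : Fin 2 => EucSp N) ℝ
    ![EuclideanSpace.single i 1, EuclideanSpace.single j 1]).continuous.comp h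

lemma ball_bounds {N : ℕ} {b : ℝ} (Q : Matrix (Fin N) (Fin N) ℂ)
    (hs : Qᵀ = Q) (hQ : ‖Q - riccatiInit N b‖ ≤ b / 2) :
    (ImPart Q)ᵀ = ImPart Q ∧ (ImPart Q - (b/2) • 1).PosSemidef ∧
      ((3*b/2) • 1 - ImPart Q).PosSemidef := by
  have hsym : (ImPart Q)ᵀ = ImPart Q := by
    conv_rhs => rw [← hs]
    rfl
  have hD : ImPart Q = ImPart (Q - riccatiInit N b) + b • 1 := by
    ext i j
    by_cases h : i = j <;> simp [ImPart, riccatiInit, h]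
  have hsymH : (ImPart Q).IsHermitian := by
    rw [Matrix.IsHermitian, Matrix.conjTranspose_eq_transpose_of_trivial, hsym]
  have h1H : ∀ c : ℝ, (c • (1 : Matrix (Fin N) (Fin N) ℝ)).IsHermitian := by
    intro c
    rw [Matrix.IsHermitian, Matrix.conjTranspose_eq_transpose_of_trivial]
    simp
  have key : ∀ x : Fin N → ℝ,
      |x ⬝ᵥ (ImPart (Q - riccatiInit N b) *ᵥ x)| ≤ b / 2 * (x ⬝ᵥ x) := fun x => by
    refine (im_form_le _ x).trans ?_
    have : 0 ≤ x ⬝ᵥ x := by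
      simp only [dotProduct]; exact Finset.sum_nonneg fun i _ => mul_self_nonneg _
    gcongr
  refine ⟨hsym, ?_, ?_⟩
  · refine Matrix.PosSemidef.of_dotProduct_mulVec_nonneg (hsymH.sub (h1H _)) fun x => ?_
    have := (abs_le.1 (key x)).1
    rw [hD]
    simp only [star_trivial, Matrix.sub_mulVec, Matrix.add_mulVec, Matrix.smul_mulVec,
      Matrix.one_mulVec, dotProduct_sub, dotProduct_add, dotProduct_smul, smul_eq_mul]
    linarith
  · refine Matrix.PosSemidef.of_dotProduct_mulVec_nonneg ((h1H _).sub hsymH) fun x => ?_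
    have := (abs_le.1 (key x)).2
    rw [hD]
    simp only [star_trivial, Matrix.sub_mulVec, Matrix.add_mulVec, Matrix.smul_mulVec,
      Matrix.one_mulVec, dotProduct_sub, dotProduct_add, dotProduct_smul, smul_eq_mul]
    linarith

lemma norm_riccatiInit_le {N : ℕ} {b : ℝ} (hb : 0 < b) : ‖riccatiInit N b‖ ≤ b := by
  have : riccatiInit N b = Matrix.diagonal (fun _ => (b : ℂ) * Complex.I) := by
    rw [riccatiInit, Matrix.smul_one_eq_diagonal]
  rw [this, Matrix.l2_opNorm_diagonal]
  refine (pi_norm_le_iff_of_nonneg hb.le).2 fun i => ?_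
  simp [abs_of_pos hb]

lemma core {N : ℕ} (b M : ℝ) (hb : 0 < b) (hM : 0 ≤ M) :
    ∃ Tstar : ℝ, 0 < Tstar ∧
      ∀ (V : EucSp N → ℝ), Subquadratic V → (∀ x, opNorm (hessMat V x) ≤ M) →
      ∀ (x_c : ℝ → EucSp N), Continuous x_c →
      ∀ (Q : ℝ → Matrix (Fin N) (Fin N) ℂ) (Tplus : EReal),
        Q 0 = riccatiInit N b →
        (∀ t : ℝ, 0 ≤ t → (t : EReal) < Tplus →
          HasDerivWithinAt Q (riccatiF V x_c Q t) (Set.Ici 0) t) →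
        (∀ (T' : ℝ) (R : ℝ → Matrix (Fin N) (Fin N) ℂ), R 0 = riccatiInit N b →
          (∀ t : ℝ, 0 ≤ t → t < T' →
            HasDerivWithinAt R (riccatiF V x_c R t) (Set.Ici 0) t) →
          (T' : EReal) ≤ Tplus) →
        (Tstar : EReal) < Tplus ∧
        ∀ t ∈ Set.Icc 0 Tstar,
          (ImPart (Q t))ᵀ = ImPart (Q t) ∧
          (ImPart (Q t) - (b/2) • 1).PosSemidef ∧
          ((3*b/2) • 1 - ImPart (Q t)).PosSemidef := by
  have hL : 0 < 9 / 4 * b ^ 2 + 2 * M := by positivity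
  obtain ⟨T, hTpos, hT⟩ : ∃ T : ℝ, 0 < T ∧ (9 / 4 * b ^ 2 + 2 * M) * T ≤ b / 2 :=
    ⟨b / 2 / (9 / 4 * b ^ 2 + 2 * M), by positivity, by rw [mul_div_cancel₀ _ hL.ne']⟩
  refine ⟨T / 2, by positivity, ?_⟩
  intro V hV hVM x_c hxc Q Tplus hQ0 hQ hmax
  let H : ℝ → Matrix (Fin N) (Fin N) ℂ := fun t => (hessMat V (x_c t)).map (fun a : ℝ => (a : ℂ))
  have hHc : Continuous H :=
    ((hessMat_cont hV).comp hxc).matrix_map Complex.continuous_ofReal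
  have hHM : ∀ t, ‖H t‖ ≤ 2 * M := fun t =>
    (norm_cmap_le _).trans (by linarith [hVM (x_c t)])
  have hHs : ∀ t, (H t)ᵀ = H t := fun t => by
    show ((hessMat V (x_c t)).map _)ᵀ = _
    rw [← Matrix.transpose_map, hessMat_symm hV]
  obtain ⟨R, hR0, hR, hRb⟩ := riccati_exists H hHc (2 * M) b hb (by positivity) hHM
    (riccatiInit N b) (norm_riccatiInit_le hb) T hTpos.le hT
  have hR' : ∀ t : ℝ, 0 ≤ t → t < T →
      HasDerivWithinAt R (-(R t ^ 2 + H t)) (Set.Ici 0) t := by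
    intro t h0 h1
    refine (hR t ⟨h0, h1.le⟩).mono_of_mem_nhdsWithin ?_
    rw [← Set.Ici_inter_Iic]
    exact Filter.inter_mem self_mem_nhdsWithin (mem_nhdsWithin_of_mem_nhds (Iic_mem_nhds h1))
  have hlt : ((T / 2 : ℝ) : EReal) < Tplus :=
    lt_of_lt_of_le (by exact_mod_cast half_lt_self hTpos) (hmax T R hR0 hR')
  refine ⟨hlt, ?_⟩
  have hRR : ∀ t ∈ Set.Icc 0 (T / 2), HasDerivWithinAt R (-(R t ^ 2 + H t)) (Set.Ici 0) t :=
    fun t ht => hR' t ht.1 (by linarith [ht.2])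
  have hQR : Set.EqOn Q R (Set.Icc 0 (T / 2)) :=
    riccati_unique H (T / 2) Q R (hQ0.trans hR0.symm)
      (fun t ht => hQ t ht.1 (lt_of_le_of_lt (by exact_mod_cast ht.2) hlt)) hRR
  have hRT : Set.EqOn (fun t => (R t)ᵀ) R (Set.Icc 0 (T / 2)) := by
    refine riccati_unique H (T / 2) _ R ?_ ?_ hRR
    · simp [hR0, riccatiInit]
    · intro t ht
      let τ : Matrix (Fin N) (Fin N) ℂ →L[ℝ] Matrix (Fin N) (Fin N) ℂ :=
        LinearMap.toContinuousLinearMap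
          (Matrix.transposeLinearEquiv (Fin N) (Fin N) ℝ ℂ).toLinearMap
      have h1 := τ.hasFDerivAt.comp_hasDerivWithinAt t (hRR t ht)
      have h2 : τ (-(R t ^ 2 + H t)) = -((R t)ᵀ ^ 2 + H t) := by
        show (-(R t ^ 2 + H t))ᵀ = _
        rw [Matrix.transpose_neg, Matrix.transpose_add, Matrix.transpose_pow, hHs]
      rw [h2] at h1
      exact h1
  intro t ht
  rw [hQR ht]
  exact ball_bounds (R t) (hRT ht) (hRb t)

end L2

attribute [local instance] Matrix.normedAddCommGroup Matrix.normedSpace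

/-- There is a time `T* > 0`, depending only on `b` and on a bound `M` for
`‖V''‖∞`, such that for every piecewise continuous control `E` and all initial data, the
maximal solution `Q` on `[0, T⁺)` of the Riccati equation `Q' + Q² + V''(x_c(t)) = 0`,
`Q(0) = i b I_N`, satisfies `T⁺ > T*`, and `Q₂(t) = Im Q(t)` is a real symmetric matrix with
`(b/2) I_N ≤ Q₂(t) ≤ (3b/2) I_N` (Loewner order) for all `t ∈ [0, T*]`. -/
theorem statement3 {N : ℕ} (hN : 1 ≤ N) (b M : ℝ) (hb : 0 < b) (hM : 0 ≤ M) :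
    ∃ Tstar : ℝ, 0 < Tstar ∧
      ∀ (V : EucSp N → ℝ), Subquadratic V → (∀ x, opNorm (hessMat V x) ≤ M) →
      ∀ (E : ℝ → EucSp N), PiecewiseContinuous E →
      ∀ (x₀ v₀ : EucSp N) (x_c v : ℝ → EucSp N), IsNewtonSol V E x₀ v₀ x_c v →
      ∀ (Q : ℝ → Matrix (Fin N) (Fin N) ℂ) (Tplus : EReal),
        Q 0 = riccatiInit N b →
        (∀ t : ℝ, 0 ≤ t → (t : EReal) < Tplus →
          HasDerivWithinAt Q (riccatiF V x_c Q t) (Set.Ici 0) t) →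
        (∀ (T' : ℝ) (R : ℝ → Matrix (Fin N) (Fin N) ℂ), R 0 = riccatiInit N b →
          (∀ t : ℝ, 0 ≤ t → t < T' →
            HasDerivWithinAt R (riccatiF V x_c R t) (Set.Ici 0) t) →
          (T' : EReal) ≤ Tplus) →
        (Tstar : EReal) < Tplus ∧
        ∀ t ∈ Set.Icc 0 Tstar,
          (ImPart (Q t))ᵀ = ImPart (Q t) ∧
          (ImPart (Q t) - (b/2) • 1).PosSemidef ∧
          ((3*b/2) • 1 - ImPart (Q t)).PosSemidef := by
  obtain ⟨T, hT, h⟩ := core (N := N) b M hb hM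
  refine ⟨T, hT, ?_⟩
  intro V hV hVM E _ x₀ v₀ x_c v hx Q Tplus hQ0 hQ hmax
  exact h V hV hVM x_c (continuous_iff_continuousAt.2 fun t => (hx.2.2.2.1 t).continuousAt)
    Q Tplus hQ0 hQ hmax
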